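/- Let λ be the Cantor–Lebesgue measure on the middle-thirds Cantor set K ⊆ [0,1]. The convolution operator f ↦ λ ∗ f maps L^{3/2}(ℝ) boundedly into L^3(ℝ). -/

import Mathlib

open MeasureTheory Set
open scoped ENNReal

/-- The map sending `x ∈ [0,1)` with binary digits `b_j` to `Σ_j 2 b_j 3^{−(j+1)}`;
it pushes Lebesgue measure on `[0,1)` forward to the Cantor–Lebesgue measure. -/
noncomputable def cantorMap (x : ℝ) : ℝ :=
  ∑' j : ℕ, (2 * ((⌊x * 2 ^ (j + 1)⌋ % 2 : ℤ) : ℝ)) / 3 ^ (j + 1)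

/-- The Cantor–Lebesgue measure on the middle-thirds Cantor set: the distribution of
`Σ_j s_j 3^{−j}` with `s_j ∈ {0,2}` i.i.d. uniform. -/
noncomputable def cantorLebesgue : Measure ℝ :=
  (volume.restrict (Set.Ico (0 : ℝ) 1)).map cantorMap

namespace CantorLebesgue

theorem three_point_real {x y z : ℝ} (hx : 0 ≤ x) (hy : 0 ≤ y) (hz : 0 ≤ z) :
    3 * (((x ^ 2 + y ^ 2) / 2) ^ 3 + ((y ^ 2 + z ^ 2) / 2) ^ 3 + ((z ^ 2 + x ^ 2) / 2) ^ 3) ≤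
      (x ^ 3 + y ^ 3 + z ^ 3) ^ 2 := by
  have key : ∀ a b : ℝ, 0 ≤ a → 0 ≤ b → 0 ≤ (a - b) ^ 4 * (a ^ 2 + 4 * a * b + b ^ 2) :=
    fun a b ha hb => by positivity
  linarith [key x y hx hy, key y z hy hz, key z x hz hx]

theorem three_point (x y z : ℝ≥0∞) :
    3 * (((x ^ 2 + y ^ 2) / 2) ^ 3 + ((y ^ 2 + z ^ 2) / 2) ^ 3 + ((z ^ 2 + x ^ 2) / 2) ^ 3) ≤
      (x ^ 3 + y ^ 3 + z ^ 3) ^ 2 := by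
  by_cases hx : x = ∞
  · simp [hx]
  by_cases hy : y = ∞
  · simp [hy]
  by_cases hz : z = ∞
  · simp [hz]
  lift x to NNReal using hx
  lift y to NNReal using hy
  lift z to NNReal using hz
  have h2 : (2 : ℝ≥0∞) = ((2 : NNReal) : ℝ≥0∞) := rfl
  have h3 : (3 : ℝ≥0∞) = ((3 : NNReal) : ℝ≥0∞) := rfl
  have := three_point_real x.2 y.2 z.2
  rw [h2, h3]
  simp only [← ENNReal.coe_pow, ← ENNReal.coe_add, ← ENNReal.coe_div (two_ne_zero' NNReal),
    ← ENNReal.coe_mul, ENNReal.coe_le_coe]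
  exact_mod_cast this

theorem tsum_half_add_pow_three_le {G H : ℤ → ℝ≥0∞} {A a b : ℝ≥0∞}
    (hG : ∑' k, G k ^ 3 ≤ A * a ^ 3) (hH : ∑' k, H k ^ 3 ≤ A * b ^ 3) :
    ∑' k, ((G k + H k) / 2) ^ 3 ≤ A * ((a + b) / 2) ^ 3 := by
  obtain ⟨α, rfl⟩ : ∃ α : ℝ≥0∞, A = α ^ 3 :=
    ⟨A ^ (1 / 3 : ℝ), by rw [← ENNReal.rpow_natCast, ← ENNReal.rpow_mul]; norm_num⟩
  have root : ∀ {s u : ℝ≥0∞}, s ≤ u ^ 3 → s ^ (1 / 3 : ℝ) ≤ u := fun {s u} h => by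
    calc s ^ (1 / 3 : ℝ) ≤ (u ^ 3) ^ (1 / 3 : ℝ) := by gcongr
      _ = u := by rw [← ENNReal.rpow_natCast, ← ENNReal.rpow_mul]; norm_num
  have mink := ENNReal.lintegral_Lp_add_le (μ := Measure.count) (p := 3)
    (measurable_from_top (f := G)).aemeasurable (measurable_from_top (f := H)).aemeasurable
    (by norm_num)
  simp only [lintegral_count, Pi.add_apply] at mink
  rw [show (3 : ℝ) = ((3 : ℕ) : ℝ) by norm_num] at mink
  simp only [ENNReal.rpow_natCast] at mink
  rw [← mul_pow] at hG hH
  have hsum : ∑' k, (G k + H k) ^ 3 ≤ (α * a + α * b) ^ 3 := by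
    have h := mink.trans (add_le_add (root hG) (root hH))
    calc ∑' k, (G k + H k) ^ 3
        = ((∑' k, (G k + H k) ^ 3) ^ (1 / ((3 : ℕ) : ℝ))) ^ 3 := by
          rw [← ENNReal.rpow_natCast (_ ^ (_ : ℝ)), ← ENNReal.rpow_mul]; norm_num
      _ ≤ _ := by gcongr
  calc ∑' k, ((G k + H k) / 2) ^ 3 = (∑' k, (G k + H k) ^ 3) * (2⁻¹) ^ 3 := by
        simp only [div_eq_mul_inv, mul_pow, ENNReal.tsum_mul_right]
    _ ≤ (α * a + α * b) ^ 3 * (2⁻¹) ^ 3 := by gcongr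
    _ = α ^ 3 * ((a + b) / 2) ^ 3 := by rw [div_eq_mul_inv]; ring

/-- Convolution on `ℤ` with the law of the `n`-digit base-`3` integers
all of whose digits are `0` or `2`. -/
noncomputable def discreteConv : ℕ → (ℤ → ℝ≥0∞) → ℤ → ℝ≥0∞
  | 0, F, m => F m
  | n + 1, F, m => (discreteConv n F m + discreteConv n F (m - 2 * 3 ^ n)) / 2

theorem discreteConv_succ_three_mul_add (n : ℕ) (F : ℤ → ℝ≥0∞) (k r : ℤ) :
    discreteConv (n + 1) F (3 * k + r) =
      (discreteConv n (fun j => F (3 * j + r)) k +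
        discreteConv n (fun j => F (3 * j + (r - 2))) k) / 2 := by
  induction n generalizing k with
  | zero => simp [discreteConv, add_sub_assoc]
  | succ n ih =>
    rw [discreteConv, ih, show 3 * k + r - 2 * 3 ^ (n + 1) = 3 * (k - 2 * 3 ^ n) + r by ring, ih,
      discreteConv, discreteConv]
    simp only [div_eq_mul_inv]
    ring

theorem tsum_int_three (G : ℤ → ℝ≥0∞) :
    ∑' m, G m = ∑' k, G (3 * k + 0) + ∑' k, G (3 * k + 1) + ∑' k, G (3 * k + 2) := by
  rw [← (Int.divModEquiv 3).symm.tsum_eq,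
    ENNReal.tsum_prod (f := fun k r => G ((Int.divModEquiv 3).symm (k, r)))]
  simp only [Int.divModEquiv_symm_apply, tsum_fintype, Fin.sum_univ_three, ENNReal.tsum_add]
  simp [mul_comm]

theorem tsum_three_mul_sub (G : ℤ → ℝ≥0∞) (r : ℤ) :
    ∑' k, G (3 * k + (r - 3)) = ∑' k, G (3 * k + r) := by
  rw [← (Equiv.subRight (1 : ℤ)).tsum_eq (fun k => G (3 * k + r))]
  refine tsum_congr fun k => congrArg G ?_
  simp only [Equiv.subRight_apply]
  ring

theorem tsum_discreteConv_pow_three_le (n : ℕ) (F : ℤ → ℝ≥0∞) :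
    ∑' m, discreteConv n F m ^ 3 ≤ (3 ^ n)⁻¹ * (∑' m, F m ^ (3 / 2 : ℝ)) ^ 2 := by
  induction n generalizing F with
  | zero =>
    have h : ∀ m, F m ^ 3 = (F m ^ (3 / 2 : ℝ)) ^ 2 := fun m => by
      rw [← ENNReal.rpow_natCast, ← ENNReal.rpow_natCast, ← ENNReal.rpow_mul]; norm_num
    simp only [discreteConv, pow_zero, inv_one, one_mul, h]
    rw [sq, ← ENNReal.tsum_mul_left]
    exact ENNReal.tsum_le_tsum fun m => by rw [sq]; gcongr; exact ENNReal.le_tsum m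
  | succ n ih =>
    set c : ℤ → ℝ≥0∞ := fun r => ∑' k, F (3 * k + r) ^ (3 / 2 : ℝ)
    have hper : ∀ r, c (r - 3) = c r := tsum_three_mul_sub (fun m => F m ^ (3 / 2 : ℝ))
    set u : ℤ → ℝ≥0∞ := fun r => c r ^ (1 / 3 : ℝ) with hu
    have hu3 : ∀ r, u r ^ 3 = c r := fun r => by
      rw [hu, ← ENNReal.rpow_natCast, ← ENNReal.rpow_mul]; norm_num
    have hu_per : ∀ r, u (r - 3) = u r := fun r => by simp only [hu, hper]
    have bound : ∀ r, ∑' k, discreteConv (n + 1) F (3 * k + r) ^ 3 ≤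
        (3 ^ n)⁻¹ * ((u r ^ 2 + u (r - 2) ^ 2) / 2) ^ 3 := fun r => by
      simp only [discreteConv_succ_three_mul_add]
      refine tsum_half_add_pow_three_le ?_ ?_ <;>
      · rw [← pow_mul, mul_comm 2 3, pow_mul, hu3]
        exact ih _
    have h0 := hu_per 1
    have h1 := hu_per 2
    have b0 := bound 0
    have b1 := bound 1
    have b2 := bound 2
    norm_num at h0 h1 b0 b1 b2
    rw [h0] at b0
    rw [h1] at b1
    rw [tsum_int_three, tsum_int_three (fun m => F m ^ (3 / 2 : ℝ))]
    change _ ≤ _ * (c 0 + c 1 + c 2) ^ 2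
    rw [← hu3, ← hu3, ← hu3]
    calc _ ≤ (3 ^ n)⁻¹ * ((u 0 ^ 2 + u 1 ^ 2) / 2) ^ 3 +
          (3 ^ n)⁻¹ * ((u 1 ^ 2 + u 2 ^ 2) / 2) ^ 3 +
          (3 ^ n)⁻¹ * ((u 2 ^ 2 + u 0 ^ 2) / 2) ^ 3 := by
          simp only [add_zero]
          exact add_le_add (add_le_add b0 b1) b2
      _ = (3 ^ (n + 1))⁻¹ * (3 * (((u 0 ^ 2 + u 1 ^ 2) / 2) ^ 3 +
          ((u 1 ^ 2 + u 2 ^ 2) / 2) ^ 3 + ((u 2 ^ 2 + u 0 ^ 2) / 2) ^ 3)) := by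
          have h : ((3 : ℝ≥0∞) ^ (n + 1))⁻¹ * 3 = (3 ^ n)⁻¹ := by
            rw [pow_succ, ENNReal.mul_inv (by simp) (by simp), mul_assoc,
              ENNReal.inv_mul_cancel (by simp) (by simp), mul_one]
          rw [← mul_assoc, h]
          ring
      _ ≤ _ := by gcongr; exact three_point _ _ _

/-- The first `n` ternary digits of `cantorMap t`, read as an integer. -/
noncomputable def digitInt : ℕ → ℝ → ℤ
  | 0, _ => 0
  | n + 1, t => 3 * digitInt n t + 2 * (⌊t * 2 ^ (n + 1)⌋ % 2)

theorem measurable_digitInt (n : ℕ) : Measurable (digitInt n) := by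
  induction n with
  | zero => exact measurable_const
  | succ n ih =>
    have h : Measurable fun t : ℝ => ⌊t * 2 ^ (n + 1)⌋ :=
      Int.measurable_floor.comp (measurable_id.mul_const _)
    exact (ih.const_mul 3).add
      ((measurable_from_top (f := fun k : ℤ => 2 * (k % 2))).comp h)

theorem digitInt_succ_half_mul {s : ℝ} (h0 : 0 ≤ s) (h1 : s < 1) (n : ℕ) :
    digitInt (n + 1) (1 / 2 * s) = digitInt n s := by
  induction n with
  | zero =>
    have : ⌊1 / 2 * s * 2 ^ (0 + 1)⌋ = 0 := by
      rw [Int.floor_eq_zero_iff]; constructor <;> norm_num <;> linarith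
    simp only [digitInt, this]; norm_num
  | succ n ih =>
    rw [digitInt, ih, digitInt, show 1 / 2 * s * 2 ^ (n + 1 + 1) = s * 2 ^ (n + 1) by ring]

theorem digitInt_succ_half_mul_add {s : ℝ} (h0 : 0 ≤ s) (h1 : s < 1) (n : ℕ) :
    digitInt (n + 1) (1 / 2 * s + 1 / 2) = digitInt n s + 2 * 3 ^ n := by
  induction n with
  | zero =>
    have : ⌊(1 / 2 * s + 1 / 2) * 2 ^ (0 + 1)⌋ = 1 := by
      rw [Int.floor_eq_iff]; constructor <;> norm_num <;> linarith
    simp only [digitInt, this]; norm_num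
  | succ n ih =>
    have : (1 / 2 * s + 1 / 2) * 2 ^ (n + 1 + 1) = s * 2 ^ (n + 1) + ((2 * 2 ^ n : ℤ) : ℝ) := by
      push_cast; ring
    rw [digitInt, ih, digitInt, this, Int.floor_add_intCast, Int.add_mul_emod_self_left]
    ring

theorem lintegral_Ico_eq_half_add (G : ℝ → ℝ≥0∞) :
    ∫⁻ t in Ico (0 : ℝ) 1, G t =
      ((∫⁻ s in Ico (0 : ℝ) 1, G (1 / 2 * s)) +
        ∫⁻ s in Ico (0 : ℝ) 1, G (1 / 2 * s + 1 / 2)) / 2 := by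
  have affine : ∀ b : ℝ, ∫⁻ t in Ico b (1 / 2 + b), G t =
      (∫⁻ s in Ico (0 : ℝ) 1, G (1 / 2 * s + b)) / 2 := fun b => by
    have himage : (fun s : ℝ => 1 / 2 * s + b) '' Ico 0 1 = Ico b (1 / 2 + b) := by
      rw [image_affine_Ico (by norm_num)]; norm_num
    have hderiv : ∀ x ∈ Ico (0 : ℝ) 1,
        HasDerivWithinAt (fun s : ℝ => 1 / 2 * s + b) (1 / 2) (Ico 0 1) x := fun x _ => by
      simpa using (((hasDerivAt_id x).const_mul (1 / 2 : ℝ)).add_const b).hasDerivWithinAt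
    have hinj : InjOn (fun s : ℝ => 1 / 2 * s + b) (Ico 0 1) := fun x _ y _ hxy => by
      simpa using hxy
    have hhalf : ENNReal.ofReal |(1 / 2 : ℝ)| = 2⁻¹ := by
      rw [abs_of_pos (by norm_num), one_div, ENNReal.ofReal_inv_of_pos (by norm_num)]; simp
    rw [← himage, lintegral_image_eq_lintegral_abs_deriv_mul measurableSet_Ico hderiv hinj, hhalf,
      lintegral_const_mul' _ _ (by simp), ENNReal.div_eq_inv_mul]
  have h0 := affine 0
  have h1 := affine (1 / 2)
  norm_num only [add_zero] at h0 h1 ⊢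
  rw [ENNReal.add_div, ← h0, ← h1, ← lintegral_union measurableSet_Ico,
    Ico_union_Ico_eq_Ico (by norm_num) (by norm_num)]
  exact Ico_disjoint_Ico_same

theorem lintegral_comp_sub_digitInt (n : ℕ) (F : ℤ → ℝ≥0∞) (m : ℤ) :
    ∫⁻ t in Ico (0 : ℝ) 1, F (m - digitInt n t) = discreteConv n F m := by
  induction n generalizing m with
  | zero => simp [digitInt, discreteConv]
  | succ n ih =>
    rw [lintegral_Ico_eq_half_add, discreteConv, ← ih, ← ih]
    congr 2 <;> refine setLIntegral_congr_fun measurableSet_Ico fun s hs => ?_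
    · simp only [digitInt_succ_half_mul hs.1 hs.2]
    · simp only [digitInt_succ_half_mul_add hs.1 hs.2, sub_sub, add_comm (digitInt n s)]

theorem tendsto_digitInt_div (t : ℝ) :
    Filter.Tendsto (fun n => (digitInt n t : ℝ) / 3 ^ n) Filter.atTop (nhds (cantorMap t)) := by
  have hs : Summable fun j : ℕ => (2 * ((⌊t * 2 ^ (j + 1)⌋ % 2 : ℤ) : ℝ)) / 3 ^ (j + 1) := by
    refine Summable.of_nonneg_of_le (fun j => ?_) (fun j => ?_)
      ((summable_geometric_of_lt_one (r := (1 / 3 : ℝ)) (by norm_num) (by norm_num)).mul_left 2)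
    · have : (0 : ℤ) ≤ ⌊t * 2 ^ (j + 1)⌋ % 2 := by omega
      have : (0 : ℝ) ≤ ((⌊t * 2 ^ (j + 1)⌋ % 2 : ℤ) : ℝ) := by exact_mod_cast this
      positivity
    · have : ⌊t * 2 ^ (j + 1)⌋ % 2 ≤ (1 : ℤ) := by omega
      have : ((⌊t * 2 ^ (j + 1)⌋ % 2 : ℤ) : ℝ) ≤ 1 := by exact_mod_cast this
      rw [one_div, inv_pow, ← div_eq_mul_inv]
      gcongr
      · linarith
      · norm_num
      · omega
  refine hs.hasSum.tendsto_sum_nat.congr fun n => ?_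
  induction n with
  | zero => simp [digitInt]
  | succ n ih =>
    rw [Finset.sum_range_succ, ih, digitInt]
    push_cast
    field_simp
    ring

theorem measurableSet_floor_mul_eq (n : ℕ) (k : ℤ) : MeasurableSet {y : ℝ | ⌊y * 3 ^ n⌋ = k} :=
  (Int.measurable_floor.comp (measurable_id.mul_const _)) (measurableSet_singleton k)

theorem lintegral_eq_tsum_floor (n : ℕ) (h : ℝ → ℝ≥0∞) :
    ∫⁻ y, h y = ∑' k : ℤ, ∫⁻ y in {y : ℝ | ⌊y * 3 ^ n⌋ = k}, h y := by
  have hunion : ⋃ k : ℤ, {y : ℝ | ⌊y * 3 ^ n⌋ = k} = univ := by ext; simp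
  rw [← lintegral_iUnion (measurableSet_floor_mul_eq n), hunion, setLIntegral_univ]
  exact fun j k hjk => Set.disjoint_left.2 fun y hj hk => hjk (hj.symm.trans hk)

theorem volume_floor_mul_eq (n : ℕ) (k : ℤ) :
    volume {y : ℝ | ⌊y * 3 ^ n⌋ = k} = (3 ^ n)⁻¹ := by
  have h3 : (0 : ℝ) < 3 ^ n := by positivity
  have hset : {y : ℝ | ⌊y * 3 ^ n⌋ = k} = Ico ((k : ℝ) / 3 ^ n) ((k + 1) / 3 ^ n) := by
    ext y
    rw [mem_ofPred_eq, Int.floor_eq_iff, mem_Ico, div_le_iff₀ h3, lt_div_iff₀ h3]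
  rw [hset, Real.volume_Ico, ← sub_div, add_sub_cancel_left, one_div,
    ENNReal.ofReal_inv_of_pos h3, ENNReal.ofReal_pow (by norm_num), ENNReal.ofReal_ofNat]

/-- The infimum of `f` over the `k`-th triadic interval of generation `n`. -/
noncomputable def cellInf (f : ℝ → ℝ≥0∞) (n : ℕ) (k : ℤ) : ℝ≥0∞ :=
  ⨅ (w : ℝ) (_ : ⌊w * 3 ^ n⌋ = k), f w

theorem tsum_cellInf_le (f : ℝ → ℝ≥0∞) (n : ℕ) :
    ∑' k, cellInf f n k ^ (3 / 2 : ℝ) ≤ 3 ^ n * ∫⁻ y, f y ^ (3 / 2 : ℝ) := by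
  have h : (3 ^ n)⁻¹ * ∑' k, cellInf f n k ^ (3 / 2 : ℝ) ≤ ∫⁻ y, f y ^ (3 / 2 : ℝ) := by
    rw [lintegral_eq_tsum_floor n, ← ENNReal.tsum_mul_left]
    refine ENNReal.tsum_le_tsum fun k => ?_
    calc (3 ^ n)⁻¹ * cellInf f n k ^ (3 / 2 : ℝ)
        = ∫⁻ _ in {y : ℝ | ⌊y * 3 ^ n⌋ = k}, cellInf f n k ^ (3 / 2 : ℝ) := by
          rw [setLIntegral_const, volume_floor_mul_eq, mul_comm]
      _ ≤ _ := by
          refine setLIntegral_mono' (measurableSet_floor_mul_eq n k) fun y hy => ?_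
          gcongr
          exact iInf₂_le y hy
  calc _ = 3 ^ n * ((3 ^ n)⁻¹ * ∑' k, cellInf f n k ^ (3 / 2 : ℝ)) := by
        rw [← mul_assoc, ENNReal.mul_inv_cancel (by simp) (by simp), one_mul]
    _ ≤ _ := by gcongr

theorem le_liminf_cellInf {f : ℝ → ℝ≥0∞} (hf : LowerSemicontinuous f) (y t : ℝ) :
    f (y - cantorMap t) ≤ Filter.liminf
      (fun n => cellInf f n (⌊y * 3 ^ n⌋ - digitInt n t)) Filter.atTop := by
  refine le_of_forall_lt fun c hc => ?_
  obtain ⟨d, hcd, hd⟩ := exists_between hc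
  refine hcd.trans_le ?_
  obtain ⟨ε, hε, hball⟩ := Metric.eventually_nhds_iff.1 (hf _ d hd)
  have hpow : Filter.Tendsto (fun n : ℕ => (1 / 3 : ℝ) ^ n) Filter.atTop (nhds 0) :=
    tendsto_pow_atTop_nhds_zero_of_lt_one (by norm_num) (by norm_num)
  have e1 := hpow.eventually (gt_mem_nhds (half_pos hε))
  have e2 := Metric.tendsto_nhds.1 (tendsto_digitInt_div t) (ε / 2) (half_pos hε)
  refine Filter.le_liminf_of_le (by isBoundedDefault) ?_
  filter_upwards [e1, e2] with n h1 h2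
  refine le_iInf₂ fun w hw => (hball ?_).le
  have h3 : (0 : ℝ) < 3 ^ n := by positivity
  rw [Int.floor_eq_iff] at hw
  push_cast at hw
  have hy1 := Int.floor_le (y * 3 ^ n)
  have hy2 := Int.lt_floor_add_one (y * 3 ^ n)
  have hX : (digitInt n t : ℝ) = (digitInt n t : ℝ) / 3 ^ n * 3 ^ n := by field_simp
  set X := (digitInt n t : ℝ) / 3 ^ n
  have hp : (1 / 3 : ℝ) ^ n * 3 ^ n = 1 := by rw [← mul_pow]; norm_num
  rw [hX] at hw
  rw [Real.dist_eq, abs_lt] at h2 ⊢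
  have a1 : w < y - X + (1 / 3) ^ n := by
    refine lt_of_mul_lt_mul_right ?_ h3.le
    rw [add_mul, sub_mul, hp]; linarith
  have a2 : y - X - (1 / 3) ^ n < w := by
    refine lt_of_mul_lt_mul_right ?_ h3.le
    rw [sub_mul, sub_mul, hp]; linarith
  constructor <;> linarith

theorem lintegral_comp_cantorMap_pow_three_le {f : ℝ → ℝ≥0∞} (hf : LowerSemicontinuous f) :
    ∫⁻ y, (∫⁻ t in Ico (0 : ℝ) 1, f (y - cantorMap t)) ^ 3 ≤
      (∫⁻ y, f y ^ (3 / 2 : ℝ)) ^ 2 := by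
  have fatou : ∀ y, (∫⁻ t in Ico (0 : ℝ) 1, f (y - cantorMap t)) ^ 3 ≤ Filter.liminf
      (fun n => discreteConv n (cellInf f n) ⌊y * 3 ^ n⌋ ^ 3) Filter.atTop := fun y => by
    have h : ∫⁻ t in Ico (0 : ℝ) 1, f (y - cantorMap t) ≤ Filter.liminf
        (fun n => discreteConv n (cellInf f n) ⌊y * 3 ^ n⌋) Filter.atTop := by
      simp only [← lintegral_comp_sub_digitInt]
      refine (lintegral_mono fun t => le_liminf_cellInf hf y t).trans
        (lintegral_liminf_le fun n => ?_)
      exact (measurable_from_top (f := fun k : ℤ => cellInf f n (⌊y * 3 ^ n⌋ - k))).comp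
        (measurable_digitInt n)
    refine (pow_le_pow_left' h 3).trans_eq ?_
    exact (pow_left_mono 3).map_liminf_of_continuousAt _ (ENNReal.continuous_pow 3).continuousAt
      (by isBoundedDefault) (by isBoundedDefault)
  refine (lintegral_mono fatou).trans ((lintegral_liminf_le fun n => ?_).trans ?_)
  · exact (measurable_from_top (f := fun k : ℤ => discreteConv n (cellInf f n) k ^ 3)).comp
      (Int.measurable_floor.comp (measurable_id.mul_const _))
  refine Filter.liminf_le_of_le (by isBoundedDefault) fun b hb => ?_
  obtain ⟨n, hn⟩ := hb.exists
  refine hn.trans ?_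
  calc ∫⁻ y : ℝ, discreteConv n (cellInf f n) ⌊y * 3 ^ n⌋ ^ 3
      = ∑' k, discreteConv n (cellInf f n) k ^ 3 * (3 ^ n)⁻¹ := by
        rw [lintegral_eq_tsum_floor n]
        refine tsum_congr fun k => ?_
        rw [← volume_floor_mul_eq n k, ← setLIntegral_const]
        exact setLIntegral_congr_fun (measurableSet_floor_mul_eq n k) fun y hy => by
          rw [mem_ofPred_eq] at hy
          simp only [hy]
    _ ≤ (3 ^ n)⁻¹ * (3 ^ n * ∫⁻ y, f y ^ (3 / 2 : ℝ)) ^ 2 * (3 ^ n)⁻¹ := by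
        rw [ENNReal.tsum_mul_right]
        gcongr
        refine (tsum_discreteConv_pow_three_le n _).trans ?_
        gcongr
        exact tsum_cellInf_le f n
    _ = ((3 ^ n)⁻¹ * 3 ^ n * ∫⁻ y, f y ^ (3 / 2 : ℝ)) ^ 2 := by ring
    _ = _ := by rw [ENNReal.inv_mul_cancel (by simp) (by simp), one_mul]

theorem lintegral_lintegral_cantorLebesgue_pow_three_le {f : ℝ → ℝ≥0∞} (hf : Measurable f) :
    ∫⁻ y, (∫⁻ x, f (y - x) ∂cantorLebesgue) ^ 3 ≤ (∫⁻ y, f y ^ (3 / 2 : ℝ)) ^ 2 := by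
  have approx : ∀ ε : ℝ≥0∞, ε ≠ 0 → ∫⁻ y, (∫⁻ x, f (y - x) ∂cantorLebesgue) ^ 3 ≤
      ((∫⁻ y, f y ^ (3 / 2 : ℝ)) + ε) ^ 2 := fun ε hε => by
    obtain ⟨g, hfg, hg, hint⟩ := exists_le_lowerSemicontinuous_lintegral_ge volume
      (fun y => f y ^ (3 / 2 : ℝ)) (hf.pow_const _) hε
    have hG : LowerSemicontinuous fun y => g y ^ (2 / 3 : ℝ) :=
      (ENNReal.continuous_rpow_const (y := 2 / 3)).comp_lowerSemicontinuous hg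
        (ENNReal.monotone_rpow_of_nonneg (by norm_num))
    have hfG : ∀ y, f y ≤ g y ^ (2 / 3 : ℝ) := fun y => by
      calc f y = (f y ^ (3 / 2 : ℝ)) ^ (2 / 3 : ℝ) := by rw [← ENNReal.rpow_mul]; norm_num
        _ ≤ _ := by gcongr; exact hfg y
    calc ∫⁻ y, (∫⁻ x, f (y - x) ∂cantorLebesgue) ^ 3
        ≤ ∫⁻ y, (∫⁻ t in Ico (0 : ℝ) 1, g (y - cantorMap t) ^ (2 / 3 : ℝ)) ^ 3 := by
          refine lintegral_mono fun y => pow_le_pow_left' ?_ 3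
          exact (lintegral_map_le _ _).trans (lintegral_mono fun t => hfG _)
      _ ≤ _ := lintegral_comp_cantorMap_pow_three_le hG
      _ = (∫⁻ y, g y) ^ 2 := by simp only [← ENNReal.rpow_mul]; norm_num
      _ ≤ _ := by gcongr
  have lim : Filter.Tendsto (fun ε : ℝ≥0∞ => ((∫⁻ y, f y ^ (3 / 2 : ℝ)) + ε) ^ 2)
      (nhdsWithin 0 (Ioi 0)) (nhds (((∫⁻ y, f y ^ (3 / 2 : ℝ)) + 0) ^ 2)) :=
    ((ENNReal.continuous_pow 2).comp (continuous_const.add continuous_id)).continuousWithinAt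
  rw [add_zero] at lim
  exact ge_of_tendsto lim (eventually_mem_nhdsWithin.mono fun ε hε => approx ε (ne_of_gt hε))

end CantorLebesgue

theorem cantorLebesgue_convolution_L32_L3 :
    ∃ C : ℝ, 0 < C ∧ ∀ f : ℝ → ℝ, Measurable f →
      eLpNorm (fun y => ∫ x, f (y - x) ∂cantorLebesgue) 3 volume ≤
        ENNReal.ofReal C * eLpNorm f (3 / 2 : ℝ≥0∞) volume := by
  refine ⟨1, one_pos, fun f hf => ?_⟩
  have h32 : (3 / 2 : ℝ≥0∞).toReal = 3 / 2 := by simp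
  rw [ENNReal.ofReal_one, one_mul,
    eLpNorm_eq_lintegral_rpow_enorm_toReal (by norm_num) (by norm_num),
    eLpNorm_eq_lintegral_rpow_enorm_toReal (by simp)
      (ENNReal.div_ne_top (by norm_num) (by norm_num)), h32, ENNReal.toReal_ofNat]
  calc (∫⁻ y, ‖∫ x, f (y - x) ∂cantorLebesgue‖ₑ ^ (3 : ℝ)) ^ (1 / 3 : ℝ)
      ≤ (∫⁻ y, (∫⁻ x, ‖f (y - x)‖ₑ ∂cantorLebesgue) ^ 3) ^ (1 / 3 : ℝ) := by
        gcongr with y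
        rw [← ENNReal.rpow_natCast, Nat.cast_ofNat]
        gcongr
        exact enorm_integral_le_lintegral_enorm _
    _ ≤ ((∫⁻ y, ‖f y‖ₑ ^ (3 / 2 : ℝ)) ^ 2) ^ (1 / 3 : ℝ) := by
        gcongr
        exact CantorLebesgue.lintegral_lintegral_cantorLebesgue_pow_three_le hf.enorm
    _ = (∫⁻ y, ‖f y‖ₑ ^ (3 / 2 : ℝ)) ^ (1 / (3 / 2) : ℝ) := by
        rw [← ENNReal.rpow_natCast, ← ENNReal.rpow_mul]; norm_num
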